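/- (Bakonyi–Johnson.) Let G be a chordal graph on vertex set [n], let d ∈ ℕ, and let M be a G-partial matrix such that for every clique S of G the fully specified principal submatrix M[S] is d-embeddable. Then M is d-completable. -/

import Mathlib

/-- `M` is a `G`-partial matrix: the specified entries (those indexed by edges of `G`)
are symmetric and nonnegative, and the diagonal is zero.  Entries at non-edges are
unspecified (their values are irrelevant). -/
def IsPartialMatrix {V : Type*} (G : SimpleGraph V) (M : V → V → ℝ) : Prop :=
  (∀ i j, G.Adj i j → M i j = M j i) ∧ (∀ i j, G.Adj i j → 0 ≤ M i j) ∧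
    (∀ i, M i i = 0)

/-- `q` is a realization of the principal submatrix `M[S]` in `ℝ^d`. -/
def IsRealizationOn {V : Type*} (d : ℕ) (M : V → V → ℝ) (S : Set V)
    (q : V → EuclideanSpace ℝ (Fin d)) : Prop :=
  ∀ u ∈ S, ∀ v ∈ S, dist (q u) (q v) ^ 2 = M u v

/-- The principal submatrix `M[S]` is `d`-embeddable. -/
def IsEmbeddableOn {V : Type*} (d : ℕ) (M : V → V → ℝ) (S : Set V) : Prop :=
  ∃ q : V → EuclideanSpace ℝ (Fin d), IsRealizationOn d M S q

/-- `B` is a `d`-metric basis of `M[S]`: `M[S]` is `d`-embeddable and in every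
realization of `M[S]` in `ℝ^d` the points indexed by `B` are affinely independent and
every point of the realization lies in their affine span. -/
def IsMetricBasisOn {V : Type*} (d : ℕ) (M : V → V → ℝ) (S B : Set V) : Prop :=
  B ⊆ S ∧ IsEmbeddableOn d M S ∧
    ∀ q : V → EuclideanSpace ℝ (Fin d), IsRealizationOn d M S q →
      AffineIndependent ℝ (fun b : B => q ↑b) ∧
      ∀ v ∈ S, q v ∈ affineSpan ℝ (q '' B)

/-- The `G`-partial matrix `M`, restricted to the vertex set `S`, is `d`-completable:
there are points in `ℝ^d`, one per vertex, realizing all specified entries between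
vertices of `S`. -/
def IsCompletableOn {V : Type*} (d : ℕ) (G : SimpleGraph V) (M : V → V → ℝ)
    (S : Set V) : Prop :=
  ∃ p : V → EuclideanSpace ℝ (Fin d), ∀ u ∈ S, ∀ v ∈ S, G.Adj u v →
    dist (p u) (p v) ^ 2 = M u v

/-- The `G`-partial matrix `M` is `d`-completable. -/
def IsCompletable {V : Type*} (d : ℕ) (G : SimpleGraph V) (M : V → V → ℝ) : Prop :=
  IsCompletableOn d G M Set.univ

/-- `G` has an induced cycle on `m` vertices. -/
def HasInducedCycle {V : Type*} (G : SimpleGraph V) (m : ℕ) : Prop :=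
  ∃ f : ZMod m → V, Function.Injective f ∧
    (∀ i : ZMod m, G.Adj (f i) (f (i + 1))) ∧
    (∀ i j : ZMod m, j ≠ i + 1 → j ≠ i - 1 → j ≠ i → ¬ G.Adj (f i) (f j))

/-- A graph is chordal if it has no induced cycle of length at least `4`. -/
def IsChordal {V : Type*} (G : SimpleGraph V) : Prop :=
  ∀ m : ℕ, 4 ≤ m → ¬ HasInducedCycle G m

section Graph

variable {V : Type*} {G : SimpleGraph V}

/-- An induced cycle given by a vertex sequence indexed by `0, …, m + 1`. -/
theorem hasInducedCycle_of_nat {m : ℕ} (w : ℕ → V)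
    (hinj : ∀ s t, s < m + 2 → t < m + 2 → w s = w t → s = t)
    (hsucc : ∀ s, s < m + 1 → G.Adj (w s) (w (s + 1)))
    (hlast : G.Adj (w (m + 1)) (w 0))
    (hadj : ∀ s t, s < t → t < m + 2 → G.Adj (w s) (w t) → t = s + 1 ∨ s = 0 ∧ t = m + 1) :
    HasInducedCycle G (m + 2) := by
  have hval (i : ZMod (m + 2)) : (i + 1).val = if i.val = m + 1 then 0 else i.val + 1 := by
    have h := i.val_lt
    rw [ZMod.val_add, ZMod.val_one'' (by omega)]
    split_ifs with hi
    · simp [hi]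
    · exact Nat.mod_eq_of_lt (by omega)
  have hnext {i j : ZMod (m + 2)} (hij : i.val < j.val) (h : G.Adj (w i.val) (w j.val)) :
      j = i + 1 ∨ i = j + 1 := by
    have hj := j.val_lt
    rcases hadj _ _ hij hj h with h | ⟨h₀, h₁⟩
    · left
      apply ZMod.val_injective
      rw [hval, if_neg (by omega), h]
    · right
      apply ZMod.val_injective
      rw [hval, if_pos h₁, h₀]
  refine ⟨fun i => w i.val, fun i j hij => ?_, fun i => ?_, fun i j h₁ h₂ h₃ h => ?_⟩
  · exact ZMod.val_injective _ (hinj _ _ i.val_lt j.val_lt hij)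
  · have h := i.val_lt
    simp only [hval]
    split_ifs with hi
    · rw [hi]
      exact hlast
    · exact hsucc _ (by omega)
  · have key : j = i + 1 ∨ i = j + 1 := by
      rcases lt_trichotomy i.val j.val with hlt | heq | hlt
      · exact hnext hlt h
      · exact absurd (ZMod.val_injective _ heq).symm h₃
      · exact (hnext hlt h.symm).symm
    rcases key with h | h
    · exact h₁ h
    · exact h₂ (by rw [h]; ring)

/-- The vertices of a shortest walk form an induced path. -/
theorem SimpleGraph.Reachable.exists_induced_path {x y : V} (h : G.Reachable x y) :
    ∃ (k : ℕ) (v : ℕ → V), v 0 = x ∧ v k = y ∧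
      (∀ i j, i ≤ k → j ≤ k → v i = v j → i = j) ∧
      (∀ i, i < k → G.Adj (v i) (v (i + 1))) ∧
      ∀ i j, j ≤ k → i < j → G.Adj (v i) (v j) → j = i + 1 := by
  obtain ⟨p, hp, hlen⟩ := h.exists_path_of_dist
  refine ⟨p.length, p.getVert, p.getVert_zero, p.getVert_length,
    fun i j hi hj hij => hp.getVert_injOn hi hj hij,
    fun i hi => p.adj_getVert_succ hi, fun i j hj hij hadj => ?_⟩
  have hle := G.dist_le ((p.take i).append (.cons hadj (p.drop j)))
  rw [SimpleGraph.Walk.length_append, SimpleGraph.Walk.length_cons,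
    SimpleGraph.Walk.take_length, SimpleGraph.Walk.drop_length] at hle
  omega

/-- In a chordal graph, two neighbours of a vertex `a` joined by a path whose interior avoids
the closed neighbourhood of `a` are adjacent. -/
theorem IsChordal.adj_of_reachable (hG : IsChordal G) {a x y : V} {T : Set V}
    (hT : ∀ v ∈ T, v ≠ a ∧ ¬ G.Adj a v) (hx : G.Adj a x) (hy : G.Adj a y) (hxy : x ≠ y)
    (h : ((⊤ : G.Subgraph).induce (T ∪ {x, y})).spanningCoe.Reachable x y) : G.Adj x y := by
  by_contra hnadj
  obtain ⟨k, v, rfl, rfl, hinj, hsucc, hind⟩ := h.exists_induced_path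
  simp only [SimpleGraph.Subgraph.spanningCoe_adj, SimpleGraph.Subgraph.induce_adj,
    SimpleGraph.Subgraph.top_adj] at hsucc hind
  have hk₀ : k ≠ 0 := by
    rintro rfl
    exact hxy rfl
  have hk₁ : k ≠ 1 := by
    rintro rfl
    exact hnadj (hsucc 0 one_pos).2.2
  have hmem (i : ℕ) (hi : i ≤ k) : v i ∈ T ∪ {v 0, v k} := by
    rcases hi.eq_or_lt with rfl | hi
    · simp
    · exact (hsucc i hi).1
  have hne (i : ℕ) (hi : i ≤ k) : v i ≠ a := by
    rcases hmem i hi with h | h | h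
    · exact (hT _ h).1
    · rw [h]
      exact hx.ne'
    · rw [h]
      exact hy.ne'
  have hend (i : ℕ) (hi : i ≤ k) (hadj : G.Adj a (v i)) : i = 0 ∨ i = k := by
    rcases hmem i hi with h | h | h
    · exact absurd hadj (hT _ h).2
    · exact .inl (hinj _ _ hi k.zero_le h)
    · exact .inr (hinj _ _ hi le_rfl h)
  have hlt {s : ℕ} (hs : s ≤ k) : (if s = k + 1 then a else v s) = v s := if_neg (by omega)
  refine hG (k + 2) (by omega)
    (hasInducedCycle_of_nat (fun s => if s = k + 1 then a else v s) ?_ ?_ ?_ ?_)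
  · intro s t hs ht hst
    split_ifs at hst with h₁ h₂ h₂
    · omega
    · exact absurd hst.symm (hne t (by omega))
    · exact absurd hst (hne s (by omega))
    · exact hinj _ _ (by omega) (by omega) hst
  · intro s hs
    rw [hlt (by omega)]
    split_ifs with h
    · obtain rfl : s = k := by omega
      exact hy.symm
    · exact (hsucc s (by omega)).2.2
  · simpa using hx
  · intro s t hst ht hadj
    rw [hlt (by omega)] at hadj
    split_ifs at hadj with h
    · rcases hend s (by omega) hadj.symm <;> omega
    · exact .inl (hind s t (by omega) hst ⟨hmem _ (by omega), hmem _ (by omega), hadj⟩)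

/-- A vertex set of a chordal graph which is not a clique is the union of two proper subsets
that meet in a clique and have no edges across. -/
theorem IsChordal.exists_clique_separation (hG : IsChordal G) {S : Set V} (hS : ¬ G.IsClique S) :
    ∃ P Q : Set V, P ⊂ S ∧ Q ⊂ S ∧ P ∪ Q = S ∧ G.IsClique (P ∩ Q) ∧
      ∀ u ∈ P \ Q, ∀ v ∈ Q \ P, ¬ G.Adj u v := by
  obtain ⟨a, ha, b, hb, hab, hnab⟩ : ∃ a ∈ S, ∃ b ∈ S, a ≠ b ∧ ¬ G.Adj a b := by
    simpa [SimpleGraph.IsClique, Set.Pairwise] using hS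
  set T : Set V := {v | v ∈ S ∧ v ≠ a ∧ ¬ G.Adj a v} with hT
  set K := ((⊤ : G.Subgraph).induce T).spanningCoe with hK
  have hKadj {u v : V} : K.Adj u v ↔ u ∈ T ∧ v ∈ T ∧ G.Adj u v := by simp [hK]
  have hbT : b ∈ T := ⟨hb, hab.symm, hnab⟩
  set B : Set V := {v | K.Reachable b v} with hB
  have hBT : B ⊆ T := by
    intro v hv
    rw [hB, Set.mem_ofPred_eq, SimpleGraph.reachable_iff_reflTransGen] at hv
    rcases hv.cases_tail with rfl | ⟨u, -, hu⟩
    · exact hbT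
    · exact (hKadj.1 hu).2.1
  have hstep {u v : V} (hu : u ∈ B) (hv : v ∈ T) (huv : G.Adj u v) : v ∈ B :=
    SimpleGraph.Reachable.trans hu (hKadj.2 ⟨hBT hu, hv, huv⟩).reachable
  have hbB : b ∈ B := .refl b
  set C : Set V := {c | c ∈ S \ B ∧ ∃ u ∈ B, G.Adj c u} with hC
  have hCa {c : V} (hc : c ∈ C) : G.Adj a c := by
    obtain ⟨⟨hcS, hcB⟩, u, hu, hcu⟩ := hc
    by_contra h
    refine hcB (hstep hu ⟨hcS, ?_, h⟩ hcu.symm)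
    rintro rfl
    exact (hBT hu).2.2 hcu
  refine ⟨S \ B, B ∪ C, ?_, ?_, ?_, ?_, ?_⟩
  · exact ⟨Set.sdiff_subset, fun h => (h hb).2 hbB⟩
  · refine ⟨Set.union_subset (fun v hv => (hBT hv).1) fun v hv => hv.1.1, fun h => ?_⟩
    rcases h ha with h | h
    · exact (hBT h).2.1 rfl
    · exact (hCa h).ne rfl
  · ext v
    constructor
    · rintro (h | h | h)
      · exact h.1
      · exact (hBT h).1
      · exact h.1.1
    · intro h
      by_cases hvB : v ∈ B
      · exact .inr (.inl hvB)
      · exact .inl ⟨h, hvB⟩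
  · have hsub {c : V} (hc : c ∈ (S \ B) ∩ (B ∪ C)) : c ∈ C :=
      hc.2.resolve_left hc.1.2
    intro x hx y hy hxy
    have hx := hsub hx
    have hy := hsub hy
    have hxa := hCa hx
    have hya := hCa hy
    obtain ⟨-, x', hx', hxx'⟩ := hx
    obtain ⟨-, y', hy', hyy'⟩ := hy
    refine hG.adj_of_reachable (T := T) (fun v hv => hv.2) hxa hya hxy ?_
    have hle : K ≤ ((⊤ : G.Subgraph).induce (T ∪ {x, y})).spanningCoe := by
      intro u v huv
      have := hKadj.1 huv
      simp only [SimpleGraph.Subgraph.spanningCoe_adj, SimpleGraph.Subgraph.induce_adj,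
        SimpleGraph.Subgraph.top_adj]
      exact ⟨.inl this.1, .inl this.2.1, this.2.2⟩
    have h₁ : ((⊤ : G.Subgraph).induce (T ∪ {x, y})).spanningCoe.Adj x x' := by
      simpa [hxx'] using Or.inr (Or.inr (hBT hx'))
    have h₂ : ((⊤ : G.Subgraph).induce (T ∪ {x, y})).spanningCoe.Adj y y' := by
      simpa [hyy'] using Or.inr (Or.inr (hBT hy'))
    exact h₁.reachable.trans <|
      ((SimpleGraph.Reachable.trans (.symm hx') hy').mono hle).trans h₂.symm.reachable
  · rintro u ⟨hu, huQ⟩ v ⟨hv, hvP⟩ huv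
    have hvB : v ∈ B := by
      rcases hv with hv | hv
      · exact hv
      · exact absurd hv.1 hvP
    exact huQ (.inr ⟨hu, v, hvB, huv⟩)

end Graph

section Euclidean

variable {E : Type*} [NormedAddCommGroup E] [InnerProductSpace ℝ E] [FiniteDimensional ℝ E]

/-- Two families of vectors with the same Gram matrix differ by a linear isometry. -/
theorem exists_linearIsometry_of_inner_eq {ι : Type*} (u w : ι → E)
    (h : ∀ i j, inner ℝ (u i) (u j) = inner ℝ (w i) (w j)) :
    ∃ f : E →ₗᵢ[ℝ] E, ∀ i, f (u i) = w i := by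
  let U := Finsupp.linearCombination ℝ u
  let W := Finsupp.linearCombination ℝ w
  have hnorm (x : ι →₀ ℝ) : ‖W x‖ = ‖U x‖ := by
    rw [← sq_eq_sq₀ (norm_nonneg _) (norm_nonneg _), ← real_inner_self_eq_norm_sq,
      ← real_inner_self_eq_norm_sq]
    simp only [U, W, Finsupp.linearCombination_apply, Finsupp.sum, sum_inner, inner_sum,
      real_inner_smul_left, real_inner_smul_right, h]
  obtain ⟨g, hg⟩ := U.rangeRestrict.exists_rightInverse_of_surjective U.range_rangeRestrict
  have hUg (y : LinearMap.range U) : U (g y) = y := congrArg Subtype.val (LinearMap.congr_fun hg y)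
  let L : LinearMap.range U →ₗᵢ[ℝ] E :=
    { toLinearMap := W ∘ₗ g
      norm_map' := fun y => by
        change ‖W (g y)‖ = ‖y‖
        rw [hnorm, hUg, Submodule.coe_norm] }
  refine ⟨L.extend, fun i => ?_⟩
  have hUi : U (Finsupp.single i 1) = u i := by simp [U]
  have hWi : W (Finsupp.single i 1) = w i := by simp [W]
  let y : LinearMap.range U := ⟨u i, Finsupp.single i 1, hUi⟩
  have hzero : W (g y - Finsupp.single i 1) = 0 := by
    rw [← norm_eq_zero, hnorm, map_sub, hUg, hUi, sub_self, norm_zero]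
  calc L.extend (u i) = L y := L.extend_apply y
    _ = W (Finsupp.single i 1) := by rwa [map_sub, sub_eq_zero] at hzero
    _ = w i := hWi

/-- Two families of points with the same mutual distances differ by an isometry of the space. -/
theorem exists_isometry_of_dist_eq {ι : Type*} (p q : ι → E)
    (h : ∀ i j, dist (p i) (p j) = dist (q i) (q j)) :
    ∃ f : E → E, Isometry f ∧ ∀ i, f (p i) = q i := by
  rcases isEmpty_or_nonempty ι with _ | ⟨⟨o⟩⟩
  · exact ⟨id, isometry_id, isEmptyElim⟩
  obtain ⟨f, hf⟩ := exists_linearIsometry_of_inner_eq (fun i => p i - p o) (fun i => q i - q o)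
    fun i j => by
      simp only [real_inner_eq_norm_mul_self_add_norm_mul_self_sub_norm_sub_mul_self_div_two,
        sub_sub_sub_cancel_right, ← dist_eq_norm, h]
  refine ⟨fun x => f (x - p o) + q o, Isometry.of_dist_eq fun x y => ?_, fun i => ?_⟩
  · rw [dist_add_right, f.dist_map, dist_sub_right]
  · simp [hf]

end Euclidean

theorem IsCompletableOn.union {V : Type*} {d : ℕ} {G : SimpleGraph V} {M : V → V → ℝ}
    {P Q : Set V} (hP : IsCompletableOn d G M P) (hQ : IsCompletableOn d G M Q)
    (hclique : G.IsClique (P ∩ Q)) (hcross : ∀ u ∈ P \ Q, ∀ v ∈ Q \ P, ¬ G.Adj u v) :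
    IsCompletableOn d G M (P ∪ Q) := by
  classical
  obtain ⟨p, hp⟩ := hP
  obtain ⟨q, hq⟩ := hQ
  obtain ⟨f, hf, hfq⟩ := exists_isometry_of_dist_eq (fun i : ↥(P ∩ Q) => p i) (fun i => q i)
    fun i j => by
      rcases eq_or_ne i j with rfl | hij
      · simp
      have hadj := hclique i.2 j.2 (Subtype.coe_injective.ne hij)
      rw [← sq_eq_sq₀ dist_nonneg dist_nonneg, hp _ i.2.1 _ j.2.1 hadj, hq _ i.2.2 _ j.2.2 hadj]
  let r : V → EuclideanSpace ℝ (Fin d) := fun v => if v ∈ P then f (p v) else q v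
  have hrP {v : V} (hv : v ∈ P) : r v = f (p v) := if_pos hv
  have hrQ {v : V} (hv : v ∈ Q) : r v = q v := by
    by_cases hvP : v ∈ P
    · rw [hrP hvP]
      exact hfq ⟨v, hvP, hv⟩
    · exact if_neg hvP
  refine ⟨r, fun u hu v hv huv => ?_⟩
  by_cases huvP : u ∈ P ∧ v ∈ P
  · rw [hrP huvP.1, hrP huvP.2, hf.dist_eq, hp u huvP.1 v huvP.2 huv]
  · have huvQ : u ∈ Q ∧ v ∈ Q := by
      have h₁ := hcross u
      have h₂ := hcross v
      have h₃ := huv.symm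
      simp only [Set.mem_union, Set.mem_sdiff] at *
      grind
    rw [hrQ huvQ.1, hrQ huvQ.2, hq u huvQ.1 v huvQ.2 huv]

theorem IsChordal.isCompletableOn {V : Type*} [Finite V] {d : ℕ} {G : SimpleGraph V}
    (hG : IsChordal G) {M : V → V → ℝ}
    (hemb : ∀ S : Set V, G.IsClique S → IsEmbeddableOn d M S) (S : Set V) :
    IsCompletableOn d G M S := by
  induction S using WellFoundedLT.induction with
  | _ S ih =>
    by_cases hS : G.IsClique S
    · obtain ⟨q, hq⟩ := hemb S hS
      exact ⟨q, fun u hu v hv _ => hq u hu v hv⟩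
    · obtain ⟨P, Q, hP, hQ, rfl, hclique, hcross⟩ := hG.exists_clique_separation hS
      exact (ih P hP).union (ih Q hQ) hclique hcross

/-- Bakonyi–Johnson: if `G` is chordal and every fully specified principal submatrix
of the `G`-partial matrix `M` indexed by a clique of `G` is `d`-embeddable, then `M`
is `d`-completable. -/
theorem bakonyi_johnson {n : ℕ} (d : ℕ) (G : SimpleGraph (Fin n))
    (hchordal : IsChordal G)
    (M : Fin n → Fin n → ℝ) (hM : IsPartialMatrix G M)
    (hemb : ∀ S : Set (Fin n), G.IsClique S → IsEmbeddableOn d M S) :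
    IsCompletable d G M := by
  exact hchordal.isCompletableOn hemb Set.univ
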